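/- Unbiasedness of the energy distance (strong form): let P, Q be probability measures on ℝ^d with finite first moments, let X₁, …, X_m be i.i.d. samples from P, and let P̂_m = (1/m)∑ᵢ δ_{Xᵢ} be the (random) empirical distribution. Then E[𝓔(P̂_m, Q)] = 𝓔(P, Q) + (1/m) ∫∫ ‖x − x′‖ dP(x)dP(x′). In particular, the expected sample energy loss differs from the true energy loss by a term independent of Q, so the energy distance has unbiased sample gradients. -/

import Mathlib

open MeasureTheory

/-- The energy distance between probability measures on `ℝ^d`:
`𝓔(P, Q) = 2 E‖X - Y‖ - E‖X - X'‖ - E‖Y - Y'‖`. -/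
noncomputable def energyDist {d : ℕ} (P Q : Measure (EuclideanSpace ℝ (Fin d))) : ℝ :=
  2 * (∫ z, ‖z.1 - z.2‖ ∂(P.prod Q))
    - (∫ z, ‖z.1 - z.2‖ ∂(P.prod P))
    - (∫ z, ‖z.1 - z.2‖ ∂(Q.prod Q))

/-- The empirical distribution `P̂_m = (1/m) ∑ᵢ δ_{Xᵢ}` of a sample vector `X`. -/
noncomputable def empiricalMeasure {d m : ℕ} (X : Fin m → EuclideanSpace ℝ (Fin d)) :
    Measure (EuclideanSpace ℝ (Fin d)) :=
  (m : ENNReal)⁻¹ • ∑ i, Measure.dirac (X i)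

theorem MeasureTheory.Integrable.norm_fst_sub_snd {E : Type*} [NormedAddCommGroup E]
    [MeasurableSpace E] [OpensMeasurableSpace E] [SecondCountableTopology E] {μ ν : Measure E}
    [IsFiniteMeasure μ] [IsFiniteMeasure ν]
    (hμ : Integrable (fun x => ‖x‖) μ) (hν : Integrable (fun y => ‖y‖) ν) :
    Integrable (fun z : E × E => ‖z.1 - z.2‖) (μ.prod ν) := by
  have h1 : Integrable (fun x : E => x) μ :=
    (integrable_norm_iff measurable_id.aestronglyMeasurable).1 hμ
  have h2 : Integrable (fun x : E => x) ν :=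
    (integrable_norm_iff measurable_id.aestronglyMeasurable).1 hν
  exact ((h1.comp_fst ν).sub (h2.comp_snd μ)).norm

theorem measurePreserving_eval_pair {ι E : Type*} [Fintype ι] [MeasurableSpace E]
    (P : Measure E) [IsProbabilityMeasure P] {i j : ι} (hij : i ≠ j) :
    MeasurePreserving (fun X : ι → E => (X i, X j)) (Measure.pi fun _ => P) (P.prod P) := by
  refine ⟨by fun_prop, ?_⟩
  have hind : ProbabilityTheory.iIndepFun (fun (k : ι) (X : ι → E) => X k)
      (Measure.pi fun _ => P) :=
    ProbabilityTheory.iIndepFun_pi (X := fun _ x => x) (fun _ => aemeasurable_id)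
  rw [(ProbabilityTheory.indepFun_iff_map_prod_eq_prod_map_map
    (measurable_pi_apply i).aemeasurable (measurable_pi_apply j).aemeasurable).1
    (hind.indepFun hij)]
  congr 1
  · exact (measurePreserving_eval (fun _ : ι => P) i).map_eq
  · exact (measurePreserving_eval (fun _ : ι => P) j).map_eq

section Empirical

variable {d m : ℕ}

theorem isProbabilityMeasure_empiricalMeasure (hm : m ≠ 0)
    (X : Fin m → EuclideanSpace ℝ (Fin d)) : IsProbabilityMeasure (empiricalMeasure X) := by
  constructor
  simp [empiricalMeasure, ENNReal.inv_mul_cancel, hm]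

theorem integrable_empiricalMeasure (hm : m ≠ 0) (X : Fin m → EuclideanSpace ℝ (Fin d))
    (f : EuclideanSpace ℝ (Fin d) → ℝ) : Integrable f (empiricalMeasure X) :=
  Integrable.smul_measure
    (integrable_finsetSum_measure.2 fun i _ => integrable_dirac (by finiteness))
    (by simp [hm])

theorem integral_empiricalMeasure (X : Fin m → EuclideanSpace ℝ (Fin d))
    (f : EuclideanSpace ℝ (Fin d) → ℝ) :
    ∫ x, f x ∂(empiricalMeasure X) = (m : ℝ)⁻¹ * ∑ i, f (X i) := by
  rw [empiricalMeasure, integral_smul_measure,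
    integral_finsetSum_measure fun i _ => integrable_dirac (by finiteness)]
  simp

theorem energyDist_empiricalMeasure (hm : m ≠ 0) {Q : Measure (EuclideanSpace ℝ (Fin d))}
    [IsProbabilityMeasure Q] (hQ : Integrable (fun y => ‖y‖) Q)
    (X : Fin m → EuclideanSpace ℝ (Fin d)) :
    energyDist (empiricalMeasure X) Q
      = 2 * ((m : ℝ)⁻¹ * ∑ i, ∫ y, ‖X i - y‖ ∂Q)
        - (m : ℝ)⁻¹ * ∑ i, (m : ℝ)⁻¹ * ∑ j, ‖X i - X j‖
        - ∫ z, ‖z.1 - z.2‖ ∂(Q.prod Q) := by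
  have := isProbabilityMeasure_empiricalMeasure hm X
  have hX := integrable_empiricalMeasure hm X (fun x => ‖x‖)
  rw [energyDist, integral_prod _ (hX.norm_fst_sub_snd hQ),
    integral_prod _ (hX.norm_fst_sub_snd hX)]
  simp only [integral_empiricalMeasure]

end Empirical

/-- Unbiasedness of the energy distance (strong form): for `P, Q` with finite first moments
and `X₁, …, X_m` i.i.d. from `P`,
`E[𝓔(P̂_m, Q)] = 𝓔(P, Q) + (1/m) ∫∫ ‖x - x'‖ dP dP`. The expected sample energy loss thus
differs from the true loss by a `Q`-independent term, so the energy distance has unbiased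
sample gradients. -/
theorem energy_unbiased {d : ℕ} (P Q : Measure (EuclideanSpace ℝ (Fin d)))
    [IsProbabilityMeasure P] [IsProbabilityMeasure Q]
    (hP : Integrable (fun x => ‖x‖) P) (hQ : Integrable (fun y => ‖y‖) Q)
    (m : ℕ) (hm : 1 ≤ m) :
    ∫ X, energyDist (empiricalMeasure X) Q ∂(Measure.pi fun _ : Fin m => P)
      = energyDist P Q + (1 / m : ℝ) * ∫ z, ‖z.1 - z.2‖ ∂(P.prod P) := by
  have hm0 : m ≠ 0 := by omega
  have hPQ := hP.norm_fst_sub_snd hQ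
  have hPP := hP.norm_fst_sub_snd hP
  have cross_int (i : Fin m) :
      Integrable (fun X : Fin m → EuclideanSpace ℝ (Fin d) => ∫ y, ‖X i - y‖ ∂Q)
        (Measure.pi fun _ => P) :=
    (measurePreserving_eval (fun _ : Fin m => P) i).integrable_comp_of_integrable
      hPQ.integral_prod_left
  have cross_eq (i : Fin m) :
      ∫ X : Fin m → EuclideanSpace ℝ (Fin d), ∫ y, ‖X i - y‖ ∂Q ∂(Measure.pi fun _ => P)
        = ∫ z, ‖z.1 - z.2‖ ∂(P.prod Q) := by
    have hi := measurePreserving_eval (fun _ : Fin m => P) i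
    have hmeas : AEStronglyMeasurable (fun x => ∫ y, ‖x - y‖ ∂Q)
        (Measure.map (Function.eval i) (Measure.pi fun _ : Fin m => P)) := by
      rw [hi.map_eq]
      exact hPQ.integral_prod_left.aestronglyMeasurable
    rw [integral_prod _ hPQ]
    have hmap := integral_map hi.measurable.aemeasurable hmeas
    rw [hi.map_eq] at hmap
    exact hmap.symm
  have pair_int (i j : Fin m) :
      Integrable (fun X : Fin m → EuclideanSpace ℝ (Fin d) => ‖X i - X j‖)
        (Measure.pi fun _ => P) := by
    rcases eq_or_ne i j with rfl | hij
    · simp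
    · exact (measurePreserving_eval_pair P hij).integrable_comp_of_integrable hPP
  have pair_eq (i j : Fin m) :
      ∫ X : Fin m → EuclideanSpace ℝ (Fin d), ‖X i - X j‖ ∂(Measure.pi fun _ => P)
        = ∫ z, ‖z.1 - z.2‖ ∂(P.prod P)
          - if i = j then ∫ z, ‖z.1 - z.2‖ ∂(P.prod P) else 0 := by
    rcases eq_or_ne i j with rfl | hij
    · simp
    · have h := measurePreserving_eval_pair P hij
      rw [if_neg hij, sub_zero, ← h.map_eq, integral_map h.measurable.aemeasurable]
      fun_prop
  have row_int (i : Fin m) :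
      Integrable (fun X : Fin m → EuclideanSpace ℝ (Fin d) => (m : ℝ)⁻¹ * ∑ j, ‖X i - X j‖)
        (Measure.pi fun _ => P) :=
    (integrable_finsetSum _ fun j _ => pair_int i j).const_mul _
  have cross_sum_int := ((integrable_finsetSum Finset.univ fun i _ => cross_int i).const_mul
    (m : ℝ)⁻¹).const_mul 2
  have pair_sum_int :=
    (integrable_finsetSum Finset.univ fun i _ => row_int i).const_mul (m : ℝ)⁻¹
  simp_rw [energyDist_empiricalMeasure hm0 hQ]
  have diff_int := cross_sum_int.sub pair_sum_int
  simp only [Pi.sub_def] at diff_int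
  rw [integral_sub diff_int (integrable_const _),
    integral_sub cross_sum_int pair_sum_int]
  simp only [integral_const_mul]
  rw [integral_finsetSum _ fun i _ => cross_int i, integral_finsetSum _ fun i _ => row_int i]
  simp only [integral_const_mul]
  simp_rw [integral_finsetSum Finset.univ fun j _ => pair_int _ j, cross_eq, pair_eq]
  have hmR : (m : ℝ) ≠ 0 := by exact_mod_cast hm0
  simp only [Finset.sum_sub_distrib, Finset.sum_const, Finset.card_univ, Fintype.card_fin,
    Finset.sum_ite_eq, Finset.mem_univ, if_true, nsmul_eq_mul, integral_const, probReal_univ,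
    one_smul, energyDist]
  field_simp
  ring
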